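/- Suppose F : K → L²(Ω) is uniformly continuous, and let X be a sticky Lagrangian solution with initial data (X̄, V̄) whose right derivative V(t) = d⁺X/dt(t) exists in L²(Ω) at every t ≥ 0; set Y(t) := V̄ + ∫₀ᵗ F[X(s)] ds. Then for all t ≥ 0: (i) V(t) ∈ H_{X(t)}; (ii) X(t) = P_K( X̄ + ∫₀ᵗ Y(s) ds ) = P_K( X̄ + t V̄ + ∫₀ᵗ (t−s) F[X(s)] ds ); (iii) V(t) = P_{H_{X(t)}}( Y(t) ). -/

import Mathlib

open MeasureTheory Set Filter
open scoped ENNReal NNReal RealInnerProductSpace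

noncomputable section

/-- The interval `Ω = (0,1)`. -/
def Omg : Set ℝ := Set.Ioo 0 1

/-- Lebesgue measure restricted to `(0,1)`. -/
def mu : Measure ℝ := volume.restrict Omg

/-- The Hilbert space `L²(Ω)`. -/
abbrev L2 : Type := Lp ℝ 2 mu

/-- The cone `K` of functions in `L²(Ω)` admitting a nondecreasing representative. -/
def Kcone : Set L2 := {X | ∃ g : ℝ → ℝ, MonotoneOn g Omg ∧ ⇑X =ᵐ[mu] g}

/-- The normal cone to `K` at `X`. -/
def normalCone (X : L2) : Set L2 := {W | ∀ Y ∈ Kcone, ⟪W, Y - X⟫ ≤ 0}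

/-- `Ω_X`: points of `Ω` near which `X` is (essentially) constant. -/
def OmegaX (X : L2) : Set ℝ :=
  {m | m ∈ Omg ∧ ∃ U ∈ nhds m, ∃ c : ℝ, ∀ᵐ x ∂(mu.restrict U), X x = c}

/-- The closed subspace `H_X` of functions admitting a representative that is constant on
each connected component of `Ω_X`. -/
def HX (X : L2) : Set L2 :=
  {U | ∃ g : ℝ → ℝ, ⇑U =ᵐ[mu] g ∧
    ∀ m ∈ OmegaX X, ∀ m' ∈ connectedComponentIn (OmegaX X) m, g m' = g m}

/-- `P` is the orthogonal projection of `V` onto `H_X`. -/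
def IsProjHX (X V P : L2) : Prop := P ∈ HX X ∧ ∀ U ∈ HX X, ⟪V - P, U⟫ = 0

/-- `P` is the metric projection of `Z` onto `K`. -/
def IsProjK (Z P : L2) : Prop := P ∈ Kcone ∧ ∀ Y ∈ Kcone, ‖P - Z‖ ≤ ‖Y - Z‖

/-- `F` is uniformly continuous on `K`. -/
def UnifCont (F : L2 → L2) : Prop :=
  (∃ C : ℝ, 0 ≤ C ∧ ∀ X ∈ Kcone, ‖F X‖ ≤ C * (1 + ‖X‖)) ∧
  (∃ ω : ℝ → ℝ, ContinuousOn ω (Set.Ici 0) ∧ ConcaveOn ℝ (Set.Ici 0) ω ∧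
    (∀ r : ℝ, 0 ≤ r → 0 ≤ ω r) ∧ ω 0 = 0 ∧ (∀ r : ℝ, 0 < r → 0 < ω r) ∧
    ∀ X₁ ∈ Kcone, ∀ X₂ ∈ Kcone, ‖F X₁ - F X₂‖ ≤ ω ‖X₁ - X₂‖)

/-- A Lagrangian solution with initial data `(X̄, V̄)`. -/
def LagSol (F : L2 → L2) (Xbar Vbar : L2) (X : ℝ → L2) : Prop :=
  (∀ t : ℝ, 0 ≤ t → X t ∈ Kcone) ∧ X 0 = Xbar ∧
  (∀ T : ℝ, ∃ L : ℝ≥0, LipschitzOnWith L X (Set.Icc 0 T)) ∧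
  (∀ᵐ t ∂(volume.restrict (Set.Ioi (0:ℝ))),
    ∃ V : L2, HasDerivAt X V t ∧
      (Vbar + ∫ s in Set.Ioc (0:ℝ) t, F (X s)) - V ∈ normalCone (X t))

/-- A sticky curve: `Ω_{X(t₁)} ⊆ Ω_{X(t₂)}` whenever `0 ≤ t₁ ≤ t₂`. -/
def StickyCurve (X : ℝ → L2) : Prop :=
  ∀ t₁ t₂ : ℝ, 0 ≤ t₁ → t₁ ≤ t₂ → OmegaX (X t₁) ⊆ OmegaX (X t₂)

instance : IsFiniteMeasure mu := by
  unfold mu Omg; infer_instance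

lemma mu_restrict_Ioo {a b : ℝ} (ha : 0 ≤ a) (hb : b ≤ 1) :
    mu.restrict (Ioo a b) = volume.restrict (Ioo a b) := by
  unfold mu Omg
  rw [Measure.restrict_restrict measurableSet_Ioo, inter_eq_left.2 (Ioo_subset_Ioo ha hb)]

lemma eq_of_ae_eq_const {f : ℝ → ℝ} {m : ℝ} (hm : m ∈ Omg) {N₁ N₂ : Set ℝ} (h₁ : N₁ ∈ nhds m)
    (h₂ : N₂ ∈ nhds m) {c₁ c₂ : ℝ} (hc₁ : ∀ᵐ x ∂(mu.restrict N₁), f x = c₁)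
    (hc₂ : ∀ᵐ x ∂(mu.restrict N₂), f x = c₂) : c₁ = c₂ := by
  have hO : IsOpen Omg := isOpen_Ioo
  have hS : N₁ ∩ N₂ ∩ Omg ∈ nhds m := inter_mem (inter_mem h₁ h₂) (hO.mem_nhds hm)
  have hne : mu.restrict (N₁ ∩ N₂) ≠ 0 := by
    intro h0
    have h3 : volume (N₁ ∩ N₂ ∩ Omg) = 0 := by
      have := congrArg (fun ν : Measure ℝ => ν univ) h0
      simpa [mu, Measure.restrict_apply' (show MeasurableSet Omg from measurableSet_Ioo)] using this
    exact (Measure.measure_pos_of_mem_nhds volume hS).ne' h3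
  have : (ae (mu.restrict (N₁ ∩ N₂))).NeBot := ae_neBot.2 hne
  have e₁ := ae_mono (Measure.restrict_mono_set mu (inter_subset_left (s := N₁) (t := N₂))) hc₁
  have e₂ := ae_mono (Measure.restrict_mono_set mu (inter_subset_right (s := N₁) (t := N₂))) hc₂
  obtain ⟨x, hx₁, hx₂⟩ := (Filter.Eventually.and e₁ e₂).exists
  exact hx₁.symm.trans hx₂

lemma isOpen_OmegaX (X : L2) : IsOpen (OmegaX X) := by
  have hO : IsOpen Omg := isOpen_Ioo
  rw [isOpen_iff_mem_nhds]
  rintro m ⟨hm, U, hU, c, hc⟩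
  filter_upwards [hO.mem_nhds hm, eventually_mem_nhds_iff.2 hU] with y hy hyU
  exact ⟨hy, U, hyU, c, hc⟩

lemma exists_ae_eq_const_of_mem_HX {X U : L2} (hU : U ∈ HX X) {J : Set ℝ} (hJ : IsPreconnected J)
    (hJX : J ⊆ OmegaX X) (hJm : MeasurableSet J) : ∃ c : ℝ, ∀ᵐ x ∂(mu.restrict J), U x = c := by
  obtain ⟨g, hg, hc⟩ := hU
  rcases J.eq_empty_or_nonempty with rfl | ⟨m, hm⟩
  · exact ⟨0, by simp⟩
  refine ⟨g m, ?_⟩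
  filter_upwards [ae_restrict_of_ae hg, ae_restrict_mem hJm] with x hx hxJ
  rw [hx]
  exact hc m (hJX hm) x (hJ.subset_connectedComponentIn hm hJX hxJ)

lemma exists_ball_subset_OmegaX {X : L2} {m : ℝ} (hm : m ∈ OmegaX X) :
    ∃ J ∈ nhds m, IsPreconnected J ∧ J ⊆ OmegaX X ∧ MeasurableSet J := by
  obtain ⟨ε, hε, h⟩ := Metric.isOpen_iff.1 (isOpen_OmegaX X) m hm
  exact ⟨Metric.ball m ε, Metric.ball_mem_nhds m hε, (convex_ball m ε).isPreconnected, h,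
    measurableSet_ball⟩

lemma mem_HX_iff {X U : L2} : U ∈ HX X ↔ OmegaX X ⊆ OmegaX U := by
  classical
  constructor
  · intro hU m hm
    obtain ⟨J, hJn, hJ, hJX, hJm⟩ := exists_ball_subset_OmegaX hm
    obtain ⟨c, hc⟩ := exists_ae_eq_const_of_mem_HX hU hJ hJX hJm
    exact ⟨hm.1, J, hJn, c, hc⟩
  · intro hsub
    have hex : ∀ m, ∃ c : ℝ, m ∈ OmegaX U → ∃ N ∈ nhds m, ∀ᵐ x ∂(mu.restrict N), U x = c := by
      intro m
      by_cases h : m ∈ OmegaX U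
      · obtain ⟨_, N, hN, c, hc⟩ := h
        exact ⟨c, fun _ => ⟨N, hN, hc⟩⟩
      · exact ⟨0, fun h' => absurd h' h⟩
    choose k hk using hex
    have hloc : ∀ m ∈ OmegaX U, ∃ N ∈ nhds m, (∀ᵐ x ∂(mu.restrict N), U x = k m) ∧
        ∀ y ∈ N, y ∈ OmegaX U ∧ k y = k m := by
      intro m hm
      obtain ⟨N, hN, hNc⟩ := hk m hm
      refine ⟨interior N ∩ OmegaX U, inter_mem (interior_mem_nhds.2 hN)
        ((isOpen_OmegaX U).mem_nhds hm), ?_, ?_⟩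
      · exact ae_mono (Measure.restrict_mono_set mu
          (inter_subset_left.trans interior_subset)) hNc
      · rintro y ⟨hyN, hyU⟩
        obtain ⟨N', hN', hc'⟩ := hk y hyU
        exact ⟨hyU, eq_of_ae_eq_const hyU.1 hN' (mem_interior_iff_mem_nhds.1 hyN) hc' hNc⟩
    refine ⟨fun m => if m ∈ OmegaX U then k m else U m, ?_, ?_⟩
    · change mu {x | ¬ _} = 0
      refine measure_null_of_locally_null _ fun m hm => ?_
      have hmU : m ∈ OmegaX U := by
        by_contra h
        simp [h] at hm
      obtain ⟨N, hN, hNc, hNy⟩ := hloc m hmU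
      obtain ⟨N', hN'N, hN'o, hmN'⟩ := mem_nhds_iff.1 hN
      refine ⟨_ ∩ N', inter_mem_nhdsWithin _ (hN'o.mem_nhds hmN'), ?_⟩
      have h1 := ae_mono (Measure.restrict_mono_set mu hN'N) hNc
      replace h1 := mem_ae_iff.1 h1
      rw [Measure.restrict_apply' hN'o.measurableSet] at h1
      refine measure_mono_null ?_ h1
      rintro x ⟨hx, hxN⟩
      refine ⟨fun hxk => hx ?_, hxN⟩
      have := hNy x (hN'N hxN)
      change U x = if x ∈ OmegaX U then k x else U x
      rw [if_pos this.1, this.2]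
      exact hxk
    · intro m hm m' hm'
      have hcU : connectedComponentIn (OmegaX X) m ⊆ OmegaX U :=
        (connectedComponentIn_subset _ _).trans hsub
      simp only [hcU hm', hsub hm, if_true]
      refine isPreconnected_connectedComponentIn.induction₂ (fun x y => k y = k x) ?_
        (fun x y z _ _ _ hxy hyz => hyz.trans hxy) (fun x y _ _ hxy => hxy.symm)
        (mem_connectedComponentIn hm) hm'
      intro x hx
      obtain ⟨N, hN, -, hNy⟩ := hloc x (hcU hx)
      exact mem_nhdsWithin_of_mem_nhds (mem_of_superset hN fun y hy => (hNy y hy).2)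

/-- `H_X` as a linear subspace. -/
def HXsub (X : L2) : Submodule ℝ L2 where
  carrier := HX X
  zero_mem' := by
    refine ⟨fun _ => 0, Lp.coeFn_zero ℝ 2 mu, fun _ _ _ _ => rfl⟩
  add_mem' := by
    rintro U W ⟨g, hg, hgc⟩ ⟨k, hk, hkc⟩
    refine ⟨fun x => g x + k x, ?_, fun m hm m' hm' => by
      simp only [hgc m hm m' hm', hkc m hm m' hm']⟩
    filter_upwards [Lp.coeFn_add U W, hg, hk] with x h1 h2 h3
    rw [h1, Pi.add_apply, h2, h3]
  smul_mem' := by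
    rintro a U ⟨g, hg, hgc⟩
    refine ⟨fun x => a * g x, ?_, fun m hm m' hm' => by simp only [hgc m hm m' hm']⟩
    filter_upwards [Lp.coeFn_smul a U, hg] with x h1 h2
    rw [h1, Pi.smul_apply, h2, smul_eq_mul]

lemma isClosed_HX (X : L2) : IsClosed (HX X) := by
  refine IsSeqClosed.isClosed fun u U hu hU => mem_HX_iff.2 fun m hm => ?_
  obtain ⟨J, hJn, hJ, hJX, hJm⟩ := exists_ball_subset_OmegaX hm
  choose c hc using fun n => exists_ae_eq_const_of_mem_HX (hu n) hJ hJX hJm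
  obtain ⟨ns, -, hns⟩ := (tendstoInMeasure_of_tendsto_Lp hU).exists_seq_tendsto_ae
  refine ⟨hm.1, J, hJn, ?_⟩
  by_cases hex : ∃ a, Tendsto (fun i => c (ns i)) atTop (nhds a)
  · obtain ⟨a, ha⟩ := hex
    refine ⟨a, ?_⟩
    filter_upwards [ae_restrict_of_ae hns, ae_all_iff.2 hc] with x hx hxc
    simp only [hxc] at hx
    exact tendsto_nhds_unique hx ha
  · refine ⟨0, ?_⟩
    filter_upwards [ae_restrict_of_ae hns, ae_all_iff.2 hc] with x hx hxc
    simp only [hxc] at hx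
    exact absurd ⟨_, hx⟩ hex

lemma memLp_comp {C : ℝ≥0} {φ : ℝ → ℝ} (hφ : LipschitzWith C φ) (X : L2) :
    MemLp (fun x => φ (X x)) 2 mu := by
  have h1 : LipschitzWith C (fun x => φ x - φ 0) := by
    simpa using hφ.sub (LipschitzWith.const (φ 0))
  have h2 := (h1.comp_memLp (by simp) (Lp.memLp X)).add (memLp_const (μ := mu) (p := 2) (φ 0))
  exact (memLp_congr_ae (ae_of_all _ fun x => by simp)).1 h2

/-- The superposition `φ ∘ X` as an element of `L²(Ω)`. -/
def superpose {C : ℝ≥0} {φ : ℝ → ℝ} (hφ : LipschitzWith C φ) (X : L2) : L2 :=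
  (memLp_comp hφ X).toLp _

lemma coeFn_superpose {C : ℝ≥0} {φ : ℝ → ℝ} (hφ : LipschitzWith C φ) (X : L2) :
    superpose hφ X =ᵐ[mu] fun x => φ (X x) := MemLp.coeFn_toLp _

lemma norm_superpose_sub_le {C : ℝ≥0} {φ : ℝ → ℝ} (hφ : LipschitzWith C φ) (X X' : L2) :
    ‖superpose hφ X - superpose hφ X'‖ ≤ C * ‖X - X'‖ := by
  refine Lp.norm_le_mul_norm_of_ae_le_mul ?_
  filter_upwards [coeFn_superpose hφ X, coeFn_superpose hφ X', Lp.coeFn_sub X X',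
    Lp.coeFn_sub (superpose hφ X) (superpose hφ X')] with x h1 h2 h3 h4
  rw [h4, h3, Pi.sub_apply, Pi.sub_apply, h1, h2]
  exact hφ.norm_sub_le _ _

lemma superpose_mem_HX {C : ℝ≥0} {φ : ℝ → ℝ} (hφ : LipschitzWith C φ) (X : L2) :
    superpose hφ X ∈ HX X := by
  refine mem_HX_iff.2 ?_
  rintro m ⟨hm, N, hN, c, hc⟩
  refine ⟨hm, N, hN, φ c, ?_⟩
  filter_upwards [hc, ae_restrict_of_ae (coeFn_superpose hφ X)] with x h1 h2
  rw [h2, h1]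

lemma inner_eq_integral (U W : L2) : ⟪U, W⟫ = ∫ x, U x * W x ∂mu := by
  rw [MeasureTheory.L2.inner_def]
  exact integral_congr_ae (ae_of_all _ fun x => by simp [mul_comm])

/-- `X + ε φ ∘ X` is still monotone when `|ε| C ≤ 1`. -/
lemma add_smul_superpose_mem_Kcone {X : L2} (hX : X ∈ Kcone) {C : ℝ≥0} {φ : ℝ → ℝ}
    (hφ : LipschitzWith C φ) {ε : ℝ} (hε : |ε| * C ≤ 1) : X + ε • superpose hφ X ∈ Kcone := by
  obtain ⟨g, hg, hgX⟩ := hX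
  refine ⟨fun x => g x + ε * φ (g x), ?_, ?_⟩
  · intro x hx y hy hxy
    have h1 := hg hx hy hxy
    have h2 : |φ (g y) - φ (g x)| ≤ C * (g y - g x) := by
      have := hφ.dist_le_mul (g y) (g x)
      rwa [Real.dist_eq, Real.dist_eq, abs_of_nonneg (sub_nonneg.2 h1)] at this
    have h3 : |ε * (φ (g y) - φ (g x))| ≤ g y - g x := by
      rw [abs_mul]
      calc |ε| * |φ (g y) - φ (g x)| ≤ |ε| * (C * (g y - g x)) := by gcongr
        _ = (|ε| * C) * (g y - g x) := by ring
        _ ≤ 1 * (g y - g x) := mul_le_mul_of_nonneg_right hε (sub_nonneg.2 h1)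
        _ = g y - g x := one_mul _
    have h4 := (abs_le.1 h3).1
    simp only
    linarith
  · filter_upwards [hgX, coeFn_superpose hφ X, Lp.coeFn_add X (ε • superpose hφ X),
      Lp.coeFn_smul ε (superpose hφ X)] with x h1 h2 h3 h4
    rw [h3, Pi.add_apply, h4, Pi.smul_apply, h2, h1, smul_eq_mul]

lemma inner_superpose_eq_zero {X W : L2} (hX : X ∈ Kcone) (hW : W ∈ normalCone X) {C : ℝ≥0}
    {φ : ℝ → ℝ} (hφ : LipschitzWith C φ) : ⟪W, superpose hφ X⟫ = 0 := by
  have hC : (0 : ℝ) < 1 + C := by positivity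
  have key : ∀ ε : ℝ, |ε| * C ≤ 1 → ε * ⟪W, superpose hφ X⟫ ≤ 0 := by
    intro ε hε
    have := hW _ (add_smul_superpose_mem_Kcone hX hφ hε)
    rwa [add_sub_cancel_left, real_inner_smul_right] at this
  have hb : |(1 + (C : ℝ))⁻¹| * C ≤ 1 := by
    rw [abs_of_pos (inv_pos.2 hC), inv_mul_le_iff₀ hC]
    linarith
  have h1 := key (1 + (C : ℝ))⁻¹ hb
  have h2 := key (-(1 + (C : ℝ))⁻¹) (by rwa [abs_neg])
  have hpos := inv_pos.2 hC
  nlinarith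

/-- If `W` is orthogonal to every Lipschitz function of `X`, it has mean zero on `{X ∈ S}` for
every `S` whose indicator is a bounded pointwise limit of Lipschitz functions. -/
lemma setIntegral_preimage_eq_zero {X W : L2}
    (hW : ∀ (C : ℝ≥0) (φ : ℝ → ℝ) (hφ : LipschitzWith C φ), ⟪W, superpose hφ X⟫ = 0)
    {S : Set ℝ} (hS : MeasurableSet S) {C : ℕ → ℝ≥0} {φ : ℕ → ℝ → ℝ}
    (hφ : ∀ n, LipschitzWith (C n) (φ n)) (hb : ∀ n x, |φ n x| ≤ 1)
    (hlim : ∀ x, Tendsto (fun n => φ n x) atTop (nhds (S.indicator 1 x))) :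
    ∫ x in X ⁻¹' S, W x ∂mu = 0 := by
  have hWi : Integrable W mu := (Lp.memLp W).integrable (by norm_num)
  have hm : MeasurableSet (X ⁻¹' S) := (Lp.stronglyMeasurable X).measurable hS
  have h0 : ∀ n, ∫ x, W x * φ n (X x) ∂mu = 0 := fun n => by
    rw [← hW _ _ (hφ n), inner_eq_integral]
    refine integral_congr_ae ?_
    filter_upwards [coeFn_superpose (hφ n) X] with x hx
    rw [hx]
  have hT : Tendsto (fun n => ∫ x, W x * φ n (X x) ∂mu) atTop
      (nhds (∫ x, W x * S.indicator 1 (X x) ∂mu)) := by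
    refine tendsto_integral_of_dominated_convergence (fun x => ‖W x‖) (fun n => ?_) hWi.norm
      (fun n => ae_of_all _ fun x => ?_) (ae_of_all _ fun x => (hlim (X x)).const_mul _)
    · exact hWi.aestronglyMeasurable.mul
        ((hφ n).continuous.comp_aestronglyMeasurable (Lp.aestronglyMeasurable X))
    · rw [norm_mul]
      exact mul_le_of_le_one_right (norm_nonneg _) (hb n _)
  simp only [h0] at hT
  rw [← integral_indicator hm, ← tendsto_nhds_unique hT tendsto_const_nhds]
  refine integral_congr_ae (ae_of_all _ fun x => ?_)
  by_cases hx : X x ∈ S <;> simp [Set.indicator, hx]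

lemma abs_clamp_le (r : ℝ) : |max 0 (min 1 r)| ≤ 1 := by
  rw [abs_of_nonneg (le_max_left _ _)]
  exact max_le zero_le_one (min_le_left _ _)

lemma lipschitzWith_clamp (n : ℕ) (b : ℝ) :
    LipschitzWith n (fun x => max 0 (min 1 (b - n * x))) := by
  refine LipschitzWith.const_max (LipschitzWith.const_min ?_ 1) 0
  refine LipschitzWith.of_dist_le_mul fun x y => ?_
  rw [Real.dist_eq, Real.dist_eq, show b - n * x - (b - n * y) = -(n * (x - y)) by ring, abs_neg,
    abs_mul]
  simp

lemma setIntegral_le_eq_zero {X W : L2}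
    (hW : ∀ (C : ℝ≥0) (φ : ℝ → ℝ) (hφ : LipschitzWith C φ), ⟪W, superpose hφ X⟫ = 0) (a : ℝ) :
    ∫ x in {x | X x ≤ a}, W x ∂mu = 0 := by
  refine setIntegral_preimage_eq_zero hW (S := Iic a) measurableSet_Iic
    (fun n => lipschitzWith_clamp n (1 + n * a)) (fun n x => abs_clamp_le _) fun x => ?_
  rcases le_or_gt x a with hx | hx
  · refine tendsto_const_nhds.congr fun n => ?_
    have : (n : ℝ) * x ≤ n * a := by gcongr
    rw [min_eq_left (by linarith), indicator_of_mem (mem_Iic.2 hx)]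
    simp
  · obtain ⟨N, hN⟩ := exists_nat_ge (x - a)⁻¹
    refine tendsto_const_nhds.congr' ?_
    filter_upwards [eventually_ge_atTop N] with n hn
    have h1 : (x - a)⁻¹ ≤ n := hN.trans (by exact_mod_cast hn)
    have h2 : 1 ≤ (n : ℝ) * (x - a) := (inv_le_iff_one_le_mul₀ (sub_pos.2 hx)).1 h1
    rw [max_eq_left ((min_le_right _ _).trans (by linarith)),
      indicator_of_notMem (by simpa using hx)]

lemma setIntegral_lt_eq_zero {X W : L2}
    (hW : ∀ (C : ℝ≥0) (φ : ℝ → ℝ) (hφ : LipschitzWith C φ), ⟪W, superpose hφ X⟫ = 0) (a : ℝ) :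
    ∫ x in {x | X x < a}, W x ∂mu = 0 := by
  refine setIntegral_preimage_eq_zero hW (S := Iio a) measurableSet_Iio
    (fun n => lipschitzWith_clamp n (n * a)) (fun n x => abs_clamp_le _) fun x => ?_
  rcases lt_or_ge x a with hx | hx
  · obtain ⟨N, hN⟩ := exists_nat_ge (a - x)⁻¹
    refine tendsto_const_nhds.congr' ?_
    filter_upwards [eventually_ge_atTop N] with n hn
    have h1 : (a - x)⁻¹ ≤ n := hN.trans (by exact_mod_cast hn)
    have h2 : 1 ≤ (n : ℝ) * (a - x) := (inv_le_iff_one_le_mul₀ (sub_pos.2 hx)).1 h1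
    rw [min_eq_left (by linarith), indicator_of_mem (mem_Iio.2 hx)]
    simp
  · refine tendsto_const_nhds.congr fun n => ?_
    have : (n : ℝ) * a ≤ n * x := by gcongr
    rw [max_eq_left ((min_le_right _ _).trans (by linarith)),
      indicator_of_notMem (by simpa using hx)]

lemma intervalIntegrable_coe (W : L2) {a b : ℝ} (ha : 0 ≤ a) (hab : a ≤ b) (hb : b ≤ 1) :
    IntervalIntegrable W volume a b := by
  have hWi : Integrable W mu := (Lp.memLp W).integrable (by norm_num)
  rw [intervalIntegrable_iff_integrableOn_Ioo_of_le hab]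
  exact IntegrableOn.mono_set (t := Omg) hWi (Ioo_subset_Ioo ha hb)

/-- A function orthogonal to every Lipschitz function of the monotone `X` has vanishing primitive
outside `Ω_X`. -/
lemma primitive_eq_zero {X W : L2} (hX : X ∈ Kcone)
    (hW : ∀ (C : ℝ≥0) (φ : ℝ → ℝ) (hφ : LipschitzWith C φ), ⟪W, superpose hφ X⟫ = 0)
    {m : ℝ} (hm0 : 0 ≤ m) (hm1 : m ≤ 1) (hm : m ∉ OmegaX X) : ∫ x in (0 : ℝ)..m, W x = 0 := by
  obtain ⟨g, hg, hgX⟩ := hX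
  have hOm : MeasurableSet Omg := measurableSet_Ioo
  have hmu : ∀ S : Set ℝ, MeasurableSet S → (∀ᵐ x ∂mu, x ∈ S ↔ x ∈ Ioo 0 m) →
      ∫ x in S, W x ∂mu = ∫ x in (0 : ℝ)..m, W x := by
    intro S hS h
    rw [intervalIntegral.integral_of_le hm0, integral_Ioc_eq_integral_Ioo,
      setIntegral_congr_set (Filter.eventuallyEq_set.2 h), mu_restrict_Ioo le_rfl hm1]
  have hXm := (Lp.stronglyMeasurable X).measurable
  have hOmg : ∀ᵐ x ∂mu, x ∈ Omg := ae_restrict_mem hOm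
  have hne : ∀ᵐ x ∂mu, x ≠ m := by
    have : ∀ᵐ x ∂(volume : Measure ℝ), x ≠ m := by simp [ae_iff]
    exact ae_restrict_of_ae this
  rcases hm0.eq_or_lt with rfl | hm0'
  · simp
  rcases hm1.eq_or_lt with rfl | hm1'
  · rw [← hmu univ MeasurableSet.univ (by filter_upwards [hOmg] with x hx; simpa [Omg] using hx),
      Measure.restrict_univ, ← hW 0 (fun _ => 1) (LipschitzWith.const 1), inner_eq_integral]
    refine integral_congr_ae ?_
    filter_upwards [coeFn_superpose (LipschitzWith.const 1) X] with x hx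
    rw [hx, mul_one]
  have hmO : m ∈ Omg := ⟨hm0', hm1'⟩
  by_cases hA : ∀ y ∈ Omg, m < y → g m < g y
  · rw [← hmu {x | X x ≤ g m} (hXm measurableSet_Iic), setIntegral_le_eq_zero hW]
    filter_upwards [hgX, hOmg, hne] with x h1 h2 h3
    rw [h1]
    constructor
    · intro h
      refine ⟨h2.1, lt_of_le_of_ne (not_lt.1 fun hlt => ?_) h3⟩
      exact (hA x h2 hlt).not_ge h
    · exact fun h => hg h2 hmO h.2.le
  by_cases hB : ∀ y ∈ Omg, y < m → g y < g m
  · rw [← hmu {x | X x < g m} (hXm measurableSet_Iio), setIntegral_lt_eq_zero hW]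
    filter_upwards [hgX, hOmg, hne] with x h1 h2 h3
    rw [h1]
    constructor
    · intro h
      refine ⟨h2.1, not_le.1 fun hle => ?_⟩
      exact h.not_ge (hg hmO h2 hle)
    · exact fun h => hB x h2 h.2
  push Not at hA hB
  obtain ⟨y, hy, hmy, hgy⟩ := hA
  obtain ⟨z, hz, hzm, hgz⟩ := hB
  refine absurd ⟨hmO, Ioo z y, Ioo_mem_nhds hzm hmy, g m, ?_⟩ hm
  filter_upwards [ae_restrict_of_ae hgX, ae_restrict_mem measurableSet_Ioo,
    ae_restrict_of_ae hOmg] with x h1 h2 h3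
  rw [h1]
  exact le_antisymm ((hg h3 hy h2.2.le).trans hgy) (hgz.trans (hg hz h3 h2.1.le))

lemma eq_zero_of_mem_HX {X W : L2} (hX : X ∈ Kcone) (hWX : W ∈ HX X)
    (hW : ∀ (C : ℝ≥0) (φ : ℝ → ℝ) (hφ : LipschitzWith C φ), ⟪W, superpose hφ X⟫ = 0) :
    W = 0 := by
  have hcl : IsClosed (OmegaX X)ᶜ := (isOpen_OmegaX X).isClosed_compl
  have h0 : (0 : ℝ) ∉ OmegaX X := fun h => lt_irrefl _ h.1.1
  have h1 : (1 : ℝ) ∉ OmegaX X := fun h => lt_irrefl _ h.1.2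
  have hprim : ∀ m ∈ Icc (0 : ℝ) 1, ∫ x in (0 : ℝ)..m, W x = 0 := by
    intro m hm
    by_cases hmX : m ∈ OmegaX X
    · obtain ⟨a, ⟨haX, ha⟩, hamax⟩ := (isCompact_Icc.inter_left hcl).exists_isGreatest
        (s := (OmegaX X)ᶜ ∩ Icc 0 m) ⟨0, h0, le_rfl, hm.1⟩
      obtain ⟨b, ⟨hbX, hb⟩, hbmin⟩ := (isCompact_Icc.inter_left hcl).exists_isLeast
        (s := (OmegaX X)ᶜ ∩ Icc m 1) ⟨1, h1, hm.2, le_rfl⟩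
      have ham : a < m := lt_of_le_of_ne ha.2 fun h => haX (h ▸ hmX)
      have hmb : m < b := lt_of_le_of_ne hb.1 fun h => hbX (h ▸ hmX)
      have hsub : Ioo a b ⊆ OmegaX X := by
        intro x hx
        by_contra hxX
        rcases le_total x m with h | h
        · exact hx.1.not_ge (hamax ⟨hxX, ha.1.trans hx.1.le, h⟩)
        · exact hx.2.not_ge (hbmin ⟨hxX, h, hx.2.le.trans hb.2⟩)
      obtain ⟨c, hc⟩ := exists_ae_eq_const_of_mem_HX hWX isPreconnected_Ioo hsub measurableSet_Ioo
      have hc' : ∀ y, a ≤ y → y ≤ b → ∫ x in a..y, W x = (y - a) * c := by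
        intro y hay hyb
        rw [mu_restrict_Ioo ha.1 hb.2] at hc
        rw [intervalIntegral.integral_of_le hay, integral_Ioc_eq_integral_Ioo,
          integral_congr_ae (ae_mono (Measure.restrict_mono_set _
            (Ioo_subset_Ioo_right hyb)) hc)]
        simp [hay]
      have hsplit : ∀ y, a ≤ y → y ≤ b → ∫ x in (0 : ℝ)..y, W x = (y - a) * c := by
        intro y hay hyb
        rw [← intervalIntegral.integral_add_adjacent_intervals
          (intervalIntegrable_coe W le_rfl ha.1 (ham.le.trans hm.2))
          (intervalIntegrable_coe W ha.1 hay (hyb.trans hb.2)),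
          primitive_eq_zero hX hW ha.1 (ham.le.trans hm.2) haX, zero_add, hc' y hay hyb]
      have hb0 := hsplit b (ham.trans hmb).le le_rfl
      rw [primitive_eq_zero hX hW (hm.1.trans hmb.le) hb.2 hbX] at hb0
      have hc0 : c = 0 := by
        rcases mul_eq_zero.1 hb0.symm with h | h
        · linarith
        · exact h
      rw [hsplit m ham.le hmb.le, hc0, mul_zero]
    · exact primitive_eq_zero hX hW hm.1 hm.2 hmX
  rw [Lp.eq_zero_iff_ae_eq_zero]
  have hI := (intervalIntegrable_coe W le_rfl zero_le_one le_rfl).ae_hasDerivAt_integral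
  have hOm : MeasurableSet Omg := measurableSet_Ioo
  change ∀ᵐ x ∂(volume.restrict Omg), W x = 0
  filter_upwards [ae_restrict_of_ae hI, ae_restrict_mem hOm] with x hx hxO
  have hd := hx (by rw [uIcc_of_le zero_le_one]; exact ⟨hxO.1.le, hxO.2.le⟩) 0 (by simp)
  have hd0 : HasDerivAt (fun y => ∫ t in (0 : ℝ)..y, W t) 0 x := by
    refine (hasDerivAt_const x (0 : ℝ)).congr_of_eventuallyEq ?_
    filter_upwards [isOpen_Ioo.mem_nhds hxO] with y hy
    exact hprim y ⟨hy.1.le, hy.2.le⟩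
  exact hd.unique hd0

lemma inner_HX_eq_zero {X W U : L2} (hX : X ∈ Kcone)
    (hW : ∀ (C : ℝ≥0) (φ : ℝ → ℝ) (hφ : LipschitzWith C φ), ⟪W, superpose hφ X⟫ = 0)
    (hU : U ∈ HX X) : ⟪W, U⟫ = 0 := by
  have : IsClosed (HXsub X : Set L2) := isClosed_HX X
  have : CompleteSpace (HXsub X) := this.completeSpace_coe
  set P : L2 := (HXsub X).starProjection W with hP
  have hPm : P ∈ HX X := (HXsub X).starProjection_apply_mem W
  have horth : ∀ u ∈ HX X, ⟪W - P, u⟫ = 0 := fun u hu =>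
    (HXsub X).starProjection_inner_eq_zero W u hu
  have hP0 : P = 0 := by
    refine eq_zero_of_mem_HX hX hPm fun C φ hφ => ?_
    have h1 := horth _ (superpose_mem_HX hφ X)
    rw [inner_sub_left, hW C φ hφ] at h1
    linarith
  simpa [hP0] using horth U hU

lemma inner_sub_le_of_ae_hasDerivAt {E : Type*} [NormedAddCommGroup E] [InnerProductSpace ℝ E]
    {D : ℝ → E} {a b M : ℝ} {L : ℝ≥0} (hab : a ≤ b) (hL : LipschitzOnWith L D (Icc a b)) (ψ : E)
    (h : ∀ᵐ s, s ∈ Ioo a b → ∃ D', HasDerivAt D D' s ∧ ⟪D', ψ⟫ ≤ M) :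
    ⟪D b - D a, ψ⟫ ≤ M * (b - a) := by
  set u : ℝ → ℝ := fun s => ⟪D s, ψ⟫ with hu
  have hLu : LipschitzOnWith (L * ‖ψ‖₊) u (uIcc a b) := by
    rw [uIcc_of_le hab]
    refine LipschitzOnWith.of_dist_le_mul fun x hx y hy => ?_
    rw [Real.dist_eq, hu, ← inner_sub_left]
    refine (abs_real_inner_le_norm _ _).trans ?_
    have := hL.dist_le_mul x hx y hy
    rw [dist_eq_norm] at this
    push_cast
    calc ‖D x - D y‖ * ‖ψ‖ ≤ (L * dist x y) * ‖ψ‖ := by gcongr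
      _ = L * ‖ψ‖ * dist x y := by ring
  have hac := hLu.absolutelyContinuousOnInterval
  rw [inner_sub_left, ← hac.integral_deriv_eq_sub]
  have hM : ∫ _ in a..b, M = M * (b - a) := by simp [mul_comm]
  rw [← hM]
  refine intervalIntegral.integral_mono_ae_restrict hab hac.intervalIntegrable_deriv (by simp) ?_
  rw [← restrict_Ioo_eq_restrict_Icc]
  filter_upwards [ae_restrict_of_ae h, ae_restrict_mem measurableSet_Ioo] with s hs hsI
  obtain ⟨D', hD', hle⟩ := hs hsI
  have : HasDerivAt u ⟪D', ψ⟫ s := by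
    simpa using hD'.inner ℝ (hasDerivAt_const s ψ)
  rwa [this.deriv]

lemma hasDerivWithinAt_zero_of_le_sq {u : ℝ → ℝ} {t K : ℝ}
    (h : ∀ s, t ≤ s → s ≤ t + 1 → |u s - u t| ≤ K * (s - t) ^ 2) :
    HasDerivWithinAt u 0 (Ici t) t := by
  rw [hasDerivWithinAt_iff_isLittleO, Asymptotics.isLittleO_iff]
  intro ε hε
  have hK : 0 < |K| + 1 := by positivity
  have hδ : 0 < min 1 (ε / (|K| + 1)) := by positivity
  filter_upwards [self_mem_nhdsWithin,
    mem_nhdsWithin_of_mem_nhds (Iio_mem_nhds (lt_add_of_pos_right t hδ))] with s hs hsδ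
  have hs' : 0 ≤ s - t := sub_nonneg.2 hs
  have hlt : s - t < min 1 (ε / (|K| + 1)) := by
    have : s < t + _ := hsδ
    linarith
  have h1 : s - t < 1 := hlt.trans_le (min_le_left _ _)
  have h2 : (s - t) * (|K| + 1) < ε := (lt_div_iff₀ hK).1 (hlt.trans_le (min_le_right _ _))
  have h3 := h s hs (by linarith)
  have h4 : K * (s - t) ≤ ε := by nlinarith [le_abs_self K]
  rw [smul_zero, sub_zero, Real.norm_eq_abs, Real.norm_eq_abs, abs_of_nonneg hs']
  calc |u s - u t| ≤ K * (s - t) * (s - t) := by rw [mul_assoc, ← sq]; exact h3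
    _ ≤ ε * (s - t) := by gcongr

lemma isProjK_of_sub_mem_normalCone {Z P : L2} (hP : P ∈ Kcone)
    (h : Z - P ∈ normalCone P) : IsProjK Z P := by
  refine ⟨hP, fun Y hY => ?_⟩
  have h1 := h Y hY
  have h2 : ‖Y - Z‖ ^ 2 = ‖Y - P‖ ^ 2 - 2 * ⟪Y - P, Z - P⟫ + ‖Z - P‖ ^ 2 := by
    rw [← norm_sub_sq_real, sub_sub_sub_cancel_right]
  rw [real_inner_comm] at h2
  rw [norm_sub_rev P Z]
  refine le_of_sq_le_sq ?_ (norm_nonneg _)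
  nlinarith [sq_nonneg ‖Y - P‖]

lemma UnifCont.continuousOn {F : L2 → L2} (hF : UnifCont F) : ContinuousOn F Kcone := by
  obtain ⟨-, ω, hωc, -, -, hω0, -, hω⟩ := hF
  intro X hX
  rw [ContinuousWithinAt, tendsto_iff_norm_sub_tendsto_zero]
  refine squeeze_zero' (Eventually.of_forall fun _ => norm_nonneg _)
    (eventually_mem_nhdsWithin.mono fun Y hY => hω Y hY X hX) ?_
  rw [← hω0]
  refine (hωc 0 self_mem_Ici).tendsto.comp (tendsto_nhdsWithin_iff.2 ⟨?_, ?_⟩)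
  · have : Tendsto (fun Y : L2 => ‖Y - X‖) (nhds X) (nhds 0) := by
      simpa using tendsto_iff_norm_sub_tendsto_zero.1 (tendsto_id (x := nhds X))
    exact this.mono_left nhdsWithin_le_nhds
  · exact Eventually.of_forall fun Y => norm_nonneg _

lemma integral_primitive_eq {E : Type*} [NormedAddCommGroup E] [NormedSpace ℝ E] [CompleteSpace E]
    {f : ℝ → E} (hf : Continuous f) (t : ℝ) :
    ∫ s in (0 : ℝ)..t, ∫ r in (0 : ℝ)..s, f r = ∫ s in (0 : ℝ)..t, (t - s) • f s := by
  have hsf : Continuous fun s => s • f s := continuous_id.smul hf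
  have hd : ∀ s, HasDerivAt (fun s => s • (∫ r in (0 : ℝ)..s, f r) - ∫ r in (0 : ℝ)..s, r • f r)
      (∫ r in (0 : ℝ)..s, f r) s := by
    intro s
    have h1 := (hasDerivAt_id s).smul (hf.integral_hasStrictDerivAt 0 s).hasDerivAt
    have h2 := (hsf.integral_hasStrictDerivAt 0 s).hasDerivAt
    exact HasDerivAt.congr_deriv (h1.sub h2) (by simp)
  have hc : Continuous fun s => ∫ r in (0 : ℝ)..s, f r :=
    intervalIntegral.continuous_primitive (fun a b => hf.intervalIntegrable a b) 0
  rw [intervalIntegral.integral_eq_sub_of_hasDerivAt (fun s _ => hd s) (hc.intervalIntegrable 0 t)]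
  simp only [sub_smul, intervalIntegral.integral_same, smul_zero, sub_zero]
  rw [intervalIntegral.integral_sub (f := fun s => t • f s)
    ((hf.const_smul t).intervalIntegrable 0 t) (hsf.intervalIntegrable 0 t),
    intervalIntegral.integral_smul]

lemma HX_anti {X X' : L2} (h : OmegaX X ⊆ OmegaX X') : HX X' ⊆ HX X :=
  fun _ hU => mem_HX_iff.2 (h.trans (mem_HX_iff.1 hU))

lemma self_mem_HX (X : L2) : X ∈ HX X := mem_HX_iff.2 Subset.rfl

lemma inner_HX_eq_zero_of_mem_normalCone {X W U : L2} (hX : X ∈ Kcone) (hW : W ∈ normalCone X)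
    (hU : U ∈ HX X) : ⟪W, U⟫ = 0 :=
  inner_HX_eq_zero hX (fun _ _ hφ => inner_superpose_eq_zero hX hW hφ) hU

/-- Normal cones increase along inclusions of the sets `Ω_X`. -/
lemma normalCone_mono {X X' : L2} (hX : X ∈ Kcone) (h : OmegaX X ⊆ OmegaX X') :
    normalCone X ⊆ normalCone X' := by
  intro W hW Y hY
  have h1 := hW Y hY
  rw [inner_sub_right, inner_HX_eq_zero_of_mem_normalCone hX hW (self_mem_HX X)] at h1
  rw [inner_sub_right, inner_HX_eq_zero_of_mem_normalCone hX hW (HX_anti h (self_mem_HX X'))]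
  exact h1

/-- **Projection formula.** Let `X` be a sticky Lagrangian solution whose
right derivative `V(t)` exists everywhere, and set `Y(t) = V̄ + ∫₀ᵗ F[X(s)] ds`. Then for
all `t ≥ 0`: (i) `V(t) ∈ H_{X(t)}`;
(ii) `X(t) = P_K(X̄ + ∫₀ᵗ Y(s) ds) = P_K(X̄ + tV̄ + ∫₀ᵗ (t−s) F[X(s)] ds)`;
(iii) `V(t) = P_{H_{X(t)}}(Y(t))`. -/
theorem stmt12 (F : L2 → L2) (hF : UnifCont F)
    (Xbar : L2) (hXbar : Xbar ∈ Kcone) (Vbar : L2)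
    (X : ℝ → L2) (hX : LagSol F Xbar Vbar X) (hsticky : StickyCurve X)
    (V : ℝ → L2)
    (hV : ∀ t : ℝ, 0 ≤ t → HasDerivWithinAt X (V t) (Set.Ici t) t) :
    ∀ t : ℝ, 0 ≤ t →
      V t ∈ HX (X t) ∧
      IsProjK (Xbar + ∫ s in Set.Ioc (0:ℝ) t,
        (Vbar + ∫ r in Set.Ioc (0:ℝ) s, F (X r))) (X t) ∧
      IsProjK (Xbar + t • Vbar + ∫ s in Set.Ioc (0:ℝ) t, (t - s) • F (X s)) (X t) ∧
      IsProjHX (X t) (Vbar + ∫ s in Set.Ioc (0:ℝ) t, F (X s)) (V t) := by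
  obtain ⟨hXK, hX0, hXL, hXae⟩ := hX
  have hXc : ContinuousOn X (Ici 0) := by
    intro s hs
    obtain ⟨L, hL⟩ := hXL (s + 1)
    refine (hL.continuousOn s ⟨hs, by linarith⟩).mono_of_mem_nhdsWithin ?_
    filter_upwards [self_mem_nhdsWithin,
      mem_nhdsWithin_of_mem_nhds (Iio_mem_nhds (lt_add_one s))] with r hr hr'
    exact ⟨hr, le_of_lt hr'⟩
  set f : ℝ → L2 := fun s => F (X (max s 0)) with hf
  have hfc : Continuous f :=
    hF.continuousOn.comp_continuous
      (hXc.comp_continuous (continuous_id.max continuous_const) fun s => le_max_right s 0)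
      fun s => hXK _ (le_max_right s 0)
  set Y : ℝ → L2 := fun s => Vbar + ∫ r in (0 : ℝ)..s, f r with hY
  set Z : ℝ → L2 := fun s => Xbar + ∫ r in (0 : ℝ)..s, Y r with hZ
  set D : ℝ → L2 := fun s => Z s - X s with hD
  have hYc : Continuous Y := continuous_const.add
    (intervalIntegral.continuous_primitive (fun a b => hfc.intervalIntegrable a b) 0)
  have hZd : ∀ s, HasDerivAt Z (Y s) s := fun s =>
    (hYc.integral_hasStrictDerivAt 0 s).hasDerivAt.const_add Xbar
  have hYeq : ∀ s, 0 ≤ s → Vbar + ∫ r in Ioc (0 : ℝ) s, F (X r) = Y s := by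
    intro s hs
    simp only [hY, intervalIntegral.integral_of_le hs]
    congr 1
    refine setIntegral_congr_fun measurableSet_Ioc fun r hr => ?_
    simp only [hf, max_eq_left hr.1.le]
  have hDL : ∀ T, ∃ L : ℝ≥0, LipschitzOnWith L D (Icc 0 T) := by
    intro T
    obtain ⟨L₁, h₁⟩ := hXL T
    have hZ1 : ContDiff ℝ 1 Z := contDiff_one_iff_deriv.2
      ⟨fun s => (hZd s).differentiableAt, by rwa [funext fun s => (hZd s).deriv]⟩
    obtain ⟨L₂, h₂⟩ := hZ1.contDiffOn.exists_lipschitzOnWith (by decide) (convex_Icc 0 T)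
      isCompact_Icc
    exact ⟨L₂ + L₁, h₂.sub h₁⟩
  have hDae : ∀ᵐ s : ℝ, 0 < s → ∃ D', HasDerivAt D D' s ∧ D' ∈ normalCone (X s) := by
    filter_upwards [(ae_restrict_iff' measurableSet_Ioi).1 hXae] with s hs hs0
    obtain ⟨W, hW, hWn⟩ := hs hs0
    rw [hYeq s (le_of_lt hs0)] at hWn
    exact ⟨Y s - W, (hZd s).sub hW, hWn⟩
  have hVH : ∀ t, 0 ≤ t → V t ∈ HX (X t) := by
    intro t ht
    have hs := (hasDerivWithinAt_iff_tendsto_slope.1 (hV t ht))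
    have hne : (nhdsWithin t (Ici t \ {t})).NeBot := by
      rw [Ici_sdiff_left]; infer_instance
    refine (isClosed_HX (X t)).mem_of_tendsto hs ?_
    filter_upwards [self_mem_nhdsWithin] with s hs
    exact (HXsub (X t)).smul_mem _ ((HXsub (X t)).sub_mem
      (HX_anti (hsticky t s ht hs.1) (self_mem_HX _)) (self_mem_HX _))
  have hproj : ∀ t, 0 ≤ t → IsProjK (Z t) (X t) := by
    intro t ht
    refine isProjK_of_sub_mem_normalCone (hXK t ht) fun W hW => ?_
    obtain ⟨L, hL⟩ := hDL t
    have h := inner_sub_le_of_ae_hasDerivAt (M := 0) ht hL (W - X t) (by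
      filter_upwards [hDae] with s hs hsI
      obtain ⟨D', hD', hn⟩ := hs hsI.1
      exact ⟨D', hD', normalCone_mono (hXK s hsI.1.le) (hsticky s t hsI.1.le hsI.2.le) hn W hW⟩)
    have hD0 : D 0 = 0 := by simp [hD, hZ, hX0]
    rwa [hD0, sub_zero, zero_mul] at h
  have horth : ∀ t, 0 ≤ t → ∀ (C : ℝ≥0) (φ : ℝ → ℝ) (hφ : LipschitzWith C φ),
      ⟪Y t - V t, superpose hφ (X t)⟫ = 0 := by
    intro t ht C φ hφ
    obtain ⟨L, hL⟩ := hDL (t + 1)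
    obtain ⟨L₁, hL₁⟩ := hXL (t + 1)
    set ψ := superpose hφ (X t) with hψ
    have hderiv : HasDerivWithinAt (fun s => ⟪D s, ψ⟫) ⟪Y t - V t, ψ⟫ (Ici t) t := by
      simpa using ((hZd t).hasDerivWithinAt.sub (hV t ht)).inner ℝ
        (hasDerivWithinAt_const t (Ici t) ψ)
    have hbound : ∀ s, t ≤ s → s ≤ t + 1 → ∀ r ∈ Ioo t s, ∀ D', HasDerivAt D D' r →
        D' ∈ normalCone (X r) → |⟪D', ψ⟫| ≤ L * (C * (L₁ * (s - t))) := by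
      intro s hts hs1 r hr D' hD' hn
      have hr0 : 0 ≤ r := ht.trans hr.1.le
      have h1 : ⟪D', ψ⟫ = ⟪D', ψ - superpose hφ (X r)⟫ := by
        rw [inner_sub_right, inner_superpose_eq_zero (hXK r hr0) hn hφ, sub_zero]
      have h2 : ‖D'‖ ≤ L := hD'.le_of_lipschitzOn
        (Icc_mem_nhds (ht.trans_lt hr.1) (hr.2.trans_le hs1)) hL
      have h3 : ‖X t - X r‖ ≤ L₁ * (s - t) := by
        rw [← dist_eq_norm]
        refine (hL₁.dist_le_mul t ⟨ht, by linarith⟩ r ⟨hr0, hr.2.le.trans hs1⟩).trans ?_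
        rw [Real.dist_eq, abs_sub_comm, abs_of_nonneg (sub_nonneg.2 hr.1.le)]
        have := hr.2.le
        gcongr
      rw [h1]
      calc |⟪D', ψ - superpose hφ (X r)⟫| ≤ ‖D'‖ * ‖ψ - superpose hφ (X r)‖ :=
            abs_real_inner_le_norm _ _
        _ ≤ L * (C * ‖X t - X r‖) := by
            gcongr
            exact norm_superpose_sub_le hφ _ _
        _ ≤ _ := by gcongr
    have hzero : HasDerivWithinAt (fun s => ⟪D s, ψ⟫) 0 (Ici t) t := by
      refine hasDerivWithinAt_zero_of_le_sq (K := L * (C * L₁)) fun s hts hs1 => ?_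
      have hLs := hL.mono (Icc_subset_Icc ht hs1)
      have hup := inner_sub_le_of_ae_hasDerivAt (M := L * (C * (L₁ * (s - t)))) hts hLs ψ (by
        filter_upwards [hDae] with r hr hrI
        obtain ⟨D', hD', hn⟩ := hr (ht.trans_lt hrI.1)
        exact ⟨D', hD', (abs_le.1 (hbound s hts hs1 r hrI D' hD' hn)).2⟩)
      have hlo := inner_sub_le_of_ae_hasDerivAt (M := L * (C * (L₁ * (s - t)))) hts hLs (-ψ) (by
        filter_upwards [hDae] with r hr hrI
        obtain ⟨D', hD', hn⟩ := hr (ht.trans_lt hrI.1)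
        refine ⟨D', hD', ?_⟩
        rw [inner_neg_right]
        linarith [(abs_le.1 (hbound s hts hs1 r hrI D' hD' hn)).1])
      rw [inner_neg_right] at hlo
      rw [← inner_sub_left, abs_le]
      constructor <;> nlinarith
    exact (uniqueDiffWithinAt_Ici t).eq_deriv _ hderiv hzero
  intro t ht
  have hZ₁ : Xbar + ∫ s in Ioc (0 : ℝ) t, (Vbar + ∫ r in Ioc (0 : ℝ) s, F (X r)) = Z t := by
    simp only [hZ, intervalIntegral.integral_of_le ht]
    congr 1
    exact setIntegral_congr_fun measurableSet_Ioc fun s hs => hYeq s hs.1.le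
  have hZ₂ : Xbar + t • Vbar + ∫ s in Ioc (0 : ℝ) t, (t - s) • F (X s) = Z t := by
    have h1 : ∫ s in Ioc (0 : ℝ) t, (t - s) • F (X s) = ∫ s in (0 : ℝ)..t, (t - s) • f s := by
      rw [intervalIntegral.integral_of_le ht]
      refine setIntegral_congr_fun measurableSet_Ioc fun r hr => ?_
      simp only [hf, max_eq_left hr.1.le]
    rw [h1, ← integral_primitive_eq hfc, add_assoc]
    simp only [hZ, hY]
    rw [intervalIntegral.integral_add (by simp) (Continuous.intervalIntegrable
      (intervalIntegral.continuous_primitive (fun a b => hfc.intervalIntegrable a b) 0) _ _)]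
    simp
  rw [hZ₁, hZ₂, hYeq t ht]
  exact ⟨hVH t ht, hproj t ht, hproj t ht, hVH t ht,
    fun U hU => inner_HX_eq_zero (hXK t ht) (horth t ht) hU⟩
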